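/- arXiv:2505.20735 — 15 statements merged into one kernel-verified Lean document; each statement's English description precedes it below -/
import Mathlib

section
/- Let (A, ∘) be a Novikov algebra, M a vector space with a bilinear operation ·, and l, r : A → End(M) linear maps. Define a bilinear operation • on the direct sum A⊕M by (a+u)•(b+v) := a∘b + l(a)v + r(b)u + u·v for a, b ∈ A and u, v ∈ M. Then (M, ·, l, r) is an A-bimodule Novikov algebra if and only if (A⊕M, •) is a Novikov algebra. -/
open TensorProduct


section Defs

variable {k : Type*} [Field k] [CharZero k]
variable {A : Type*} [AddCommGroup A] [Module k A]
variable {M : Type*} [AddCommGroup M] [Module k M]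

/-- A bilinear operation satisfying the Novikov algebra axioms. -/
def IsNovikov (mul : A →ₗ[k] A →ₗ[k] A) : Prop :=
  (∀ a b c : A, mul (mul a b) c - mul a (mul b c) = mul (mul b a) c - mul b (mul a c)) ∧
  (∀ a b c : A, mul (mul a b) c = mul (mul a c) b)

/-- `(M, l, r)` is a bimodule of the Novikov algebra `(A, mul)`. -/
def IsNovikovBimodule (mul : A →ₗ[k] A →ₗ[k] A)
    (l r : A →ₗ[k] Module.End k M) : Prop :=
  (∀ (a b : A) (v : M), l (mul a b - mul b a) v = l a (l b v) - l b (l a v)) ∧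
  (∀ (a b : A) (v : M), l a (r b v) - r b (l a v) = r (mul a b) v - r b (r a v)) ∧
  (∀ (a b : A) (v : M), l (mul a b) v = r b (l a v)) ∧
  (∀ (a b : A) (v : M), r a (r b v) = r b (r a v))

/-- `(M, mulM, l, r)` is an `A`-bimodule Novikov algebra over the Novikov algebra `(A, mulA)`. -/
def IsBimoduleNovikovAlgebra (mulA : A →ₗ[k] A →ₗ[k] A)
    (mulM : M →ₗ[k] M →ₗ[k] M) (l r : A →ₗ[k] Module.End k M) : Prop :=
  IsNovikov mulM ∧ IsNovikovBimodule mulA l r ∧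
  (∀ (a : A) (v w : M), mulM (l a v) w - l a (mulM v w) = mulM (r a v) w - mulM v (l a w)) ∧
  (∀ (a : A) (v w : M), r a (mulM v w) - mulM v (r a w) = r a (mulM w v) - mulM w (r a v)) ∧
  (∀ (a : A) (v w : M), mulM (l a v) w = mulM (l a w) v) ∧
  (∀ (a : A) (v w : M), r a (mulM v w) = mulM (r a v) w)

/-- O-operator of weight `lam` on `(A, mulA)` associated to the A-bimodule Novikov algebra
`(M, mulM, l, r)`. -/
def IsOOperator (mulA : A →ₗ[k] A →ₗ[k] A) (mulM : M →ₗ[k] M →ₗ[k] M)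
    (l r : A →ₗ[k] Module.End k M) (lam : k) (α : M →ₗ[k] A) : Prop :=
  ∀ u v : M, mulA (α u) (α v) = α (l (α u) v + r (α v) u + lam • mulM u v)

/-- Post-Novikov algebra axioms: `circ` is Novikov and the eight compatibility conditions hold,
where `lhd a b = a ◁ b` and `rhd a b = a ▷ b`. -/
def IsPostNovikov (circ lhd rhd : A →ₗ[k] A →ₗ[k] A) : Prop :=
  IsNovikov circ ∧
  (∀ a b c : A, lhd (rhd a c) b = rhd (rhd a b + lhd a b + circ a b) c) ∧
  (∀ a b c : A, rhd a (lhd c b) - lhd (rhd a c) b + lhd (lhd c a) b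
      = lhd c (lhd a b + rhd a b + circ a b)) ∧
  (∀ a b c : A, rhd (rhd a b + lhd a b + circ a b) c - rhd (rhd b a + lhd b a + circ b a) c
      = rhd a (rhd b c) - rhd b (rhd a c)) ∧
  (∀ a b c : A, lhd (lhd a b) c = lhd (lhd a c) b) ∧
  (∀ a b c : A, circ (rhd a b) c - rhd a (circ b c) = circ (lhd b a) c - circ b (rhd a c)) ∧
  (∀ a b c : A, lhd (circ b c) a - circ b (lhd c a) = lhd (circ c b) a - circ c (lhd b a)) ∧
  (∀ a b c : A, circ (rhd a b) c = circ (rhd a c) b) ∧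
  (∀ a b c : A, lhd (circ a b) c = circ (lhd a c) b)

/-- Rota-Baxter operator of weight `lam` on the Novikov algebra `(A, mulA)`. -/
def IsRotaBaxter (mulA : A →ₗ[k] A →ₗ[k] A) (lam : k) (T : A →ₗ[k] A) : Prop :=
  ∀ x y : A, mulA (T x) (T y) = T (mulA (T x) y + mulA x (T y) + lam • mulA x y)

/-- `β : M → A` is balanced. -/
def IsBalanced (l r : A →ₗ[k] Module.End k M) (β : M →ₗ[k] A) : Prop :=
  ∀ u v : M, l (β u) v = r (β v) u

/-- `β : M → A` is A-invariant of mass `κ`. -/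
def IsAInvariant (mulA : A →ₗ[k] A →ₗ[k] A) (l r : A →ₗ[k] Module.End k M)
    (κ : k) (β : M →ₗ[k] A) : Prop :=
  (∀ (x : A) (u : M), κ • mulA x (β u) = κ • β (l x u)) ∧
  (∀ (x : A) (u : M), κ • mulA (β u) x = κ • β (r x u))

/-- `β : M → A` is equivalent of mass `μ`. -/
def IsEquivalentOfMass (mulM : M →ₗ[k] M →ₗ[k] M) (l r : A →ₗ[k] Module.End k M)
    (μ : k) (β : M →ₗ[k] A) : Prop :=
  (∀ u v w : M, μ • l (β (mulM u v)) w = μ • mulM (l (β u) v) w) ∧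
  (∀ u v w : M, μ • r (β (mulM v w)) u = μ • mulM u (r (β w) v))

/-- `β : M → A` is an A-bimodule homomorphism from `(M, l, r)` to `(A, L_A, R_A)`. -/
def IsBimoduleHom (mulA : A →ₗ[k] A →ₗ[k] A) (l r : A →ₗ[k] Module.End k M)
    (β : M →ₗ[k] A) : Prop :=
  (∀ (x : A) (u : M), β (l x u) = mulA x (β u)) ∧
  (∀ (x : A) (u : M), β (r x u) = mulA (β u) x)

/-- Extended O-operator of weight `lam` with extension `β` of mass `(κ, μ)`. -/
def IsExtendedOOperator (mulA : A →ₗ[k] A →ₗ[k] A) (mulM : M →ₗ[k] M →ₗ[k] M)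
    (l r : A →ₗ[k] Module.End k M) (lam κ μ : k) (α β : M →ₗ[k] A) : Prop :=
  IsBalanced l r β ∧ IsAInvariant mulA l r κ β ∧ IsEquivalentOfMass mulM l r μ β ∧
  ∀ u v : M, mulA (α u) (α v) - α (l (α u) v + r (α v) u + lam • mulM u v)
    = κ • mulA (β u) (β v) + μ • β (mulM u v)

end Defs

section SDDefs
variable {k : Type*} [Field k] [CharZero k]
variable {A : Type*} [AddCommGroup A] [Module k A]
variable {M : Type*} [AddCommGroup M] [Module k M]

/-- The bilinear product on `A ⊕ M`:
`(a + u) • (b + v) = a∘b + l(a)v + r(b)u + u·v`. -/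
noncomputable def sdMul (mulA : A →ₗ[k] A →ₗ[k] A) (mulM : M →ₗ[k] M →ₗ[k] M)
    (l r : A →ₗ[k] Module.End k M) :
    (A × M) →ₗ[k] (A × M) →ₗ[k] (A × M) :=
  LinearMap.mk₂ k
    (fun p q => (mulA p.1 q.1, l p.1 q.2 + r q.1 p.2 + mulM p.2 q.2))
    (fun p p' q => by
      simp only [Prod.fst_add, Prod.snd_add, map_add, LinearMap.add_apply, Prod.mk_add_mk,
        Prod.mk.injEq]
      exact ⟨trivial, by abel⟩)
    (fun c p q => by
      simp only [Prod.smul_fst, Prod.smul_snd, map_smul, LinearMap.smul_apply, Prod.smul_mk,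
        Prod.mk.injEq]
      exact ⟨trivial, by rw [smul_add, smul_add]⟩)
    (fun p q q' => by
      simp only [Prod.fst_add, Prod.snd_add, map_add, LinearMap.add_apply, Prod.mk_add_mk,
        Prod.mk.injEq]
      exact ⟨trivial, by abel⟩)
    (fun c p q => by
      simp only [Prod.smul_fst, Prod.smul_snd, map_smul, LinearMap.smul_apply, Prod.smul_mk,
        Prod.mk.injEq]
      exact ⟨trivial, by rw [smul_add, smul_add]⟩)

end SDDefs

/-- The product on `A ⊕ M` evaluated on pairs. -/
theorem sdMul_mk_mk
    {k : Type*} [Field k] [CharZero k]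
    {A : Type*} [AddCommGroup A] [Module k A]
    {M : Type*} [AddCommGroup M] [Module k M]
    (mulA : A →ₗ[k] A →ₗ[k] A) (mulM : M →ₗ[k] M →ₗ[k] M)
    (l r : A →ₗ[k] Module.End k M) (a b : A) (u v : M) :
    sdMul mulA mulM l r (a, u) (b, v) = (mulA a b, l a v + r b u + mulM u v) := rfl

/-- `(M, ·, l, r)` is an `A`-bimodule Novikov algebra if and only if the
semidirect-type product `•` on `A ⊕ M` is a Novikov algebra. -/
theorem bimoduleNovikov_iff_sdMul_isNovikov
    {k : Type*} [Field k] [CharZero k]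
    {A : Type*} [AddCommGroup A] [Module k A]
    {M : Type*} [AddCommGroup M] [Module k M]
    (mulA : A →ₗ[k] A →ₗ[k] A) (hA : IsNovikov mulA)
    (mulM : M →ₗ[k] M →ₗ[k] M) (l r : A →ₗ[k] Module.End k M) :
    IsBimoduleNovikovAlgebra mulA mulM l r ↔ IsNovikov (sdMul mulA mulM l r) := by
  constructor
  · rintro ⟨⟨hM₁, hM₂⟩, ⟨hl, hlr, hl', hr⟩, h₁, h₂, h₃, h₄⟩
    refine ⟨?_, ?_⟩
    · rintro ⟨a, u⟩ ⟨b, v⟩ ⟨c, w⟩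
      simp only [sdMul_mk_mk, Prod.mk_sub_mk, Prod.mk.injEq]
      refine ⟨hA.1 a b c, ?_⟩
      have e₁ := hl a b w
      simp only [map_sub, LinearMap.sub_apply] at e₁
      simp only [map_add, LinearMap.add_apply]
      linear_combination (norm := module) e₁ - hlr a c v + hlr b c u + h₁ a v w - h₁ b u w
        + h₂ c u v + hM₁ u v w
    · rintro ⟨a, u⟩ ⟨b, v⟩ ⟨c, w⟩
      simp only [sdMul_mk_mk, Prod.mk.injEq]
      refine ⟨hA.2 a b c, ?_⟩
      simp only [map_add, LinearMap.add_apply]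
      linear_combination (norm := module) hl' a b w - hl' a c v + hr c b u + h₃ a v w
        + h₄ c u v - h₄ b u w + hM₂ u v w
  · rintro ⟨hs, hc⟩
    have assoc (a b c : A) (u v w : M) := congrArg Prod.snd (hs (a, u) (b, v) (c, w))
    have comm (a b c : A) (u v w : M) := congrArg Prod.snd (hc (a, u) (b, v) (c, w))
    simp only [sdMul_mk_mk, Prod.snd_sub] at assoc comm
    refine ⟨⟨fun u v w => ?_, fun u v w => ?_⟩, ⟨fun a b v => ?_, fun a b v => ?_,
      fun a b v => ?_, fun a b v => ?_⟩, fun a v w => ?_, fun a v w => ?_, fun a v w => ?_,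
      fun a v w => ?_⟩
    · simpa using assoc 0 0 0 u v w
    · simpa using comm 0 0 0 u v w
    · have h := assoc a b 0 0 0 v
      simp only [map_zero, map_sub, LinearMap.zero_apply, LinearMap.sub_apply, add_zero] at h ⊢
      linear_combination (norm := module) h
    · have h := assoc a 0 b 0 v 0
      simp only [map_zero, LinearMap.zero_apply, add_zero, zero_add] at h
      linear_combination (norm := module) -h
    · simpa using comm a b 0 0 0 v
    · simpa using comm 0 b a v 0 0
    · simpa using assoc a 0 0 0 v w
    · simpa using assoc 0 0 a v w 0
    · simpa using comm a 0 0 0 v w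
    · simpa using comm 0 0 a v w 0
end

section
/- Let (A, ·, ∘) be a commutative dendriform trialgebra with a derivation D (i.e. D(a·b) = D(a)·b + a·D(b) and D(a∘b) = D(a)∘b + a∘D(b) for all a, b). Define bilinear operations on A by a∗b := a·D(b), a◁b := a∘D(b), and a▷b := D(b)∘a. Then (A, ∗, ◁, ▷) is a post-Novikov algebra (in particular (A, ∗) is a Novikov algebra). -/
open TensorProduct


/-- A commutative dendriform trialgebra `(A, ·, ∘)` with a derivation `D`
gives a post-Novikov algebra `(A, ∗, ◁, ▷)` with `a∗b = a·D(b)`, `a◁b = a∘D(b)`,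
`a▷b = D(b)∘a`. -/
theorem commDendriformTrialgebra_derivation_postNovikov
    {k : Type*} [Field k] [CharZero k]
    {A : Type*} [AddCommGroup A] [Module k A]
    (dot circ : A →ₗ[k] A →ₗ[k] A) (D : A →ₗ[k] A)
    (hcomm : ∀ a b : A, dot a b = dot b a)
    (hassoc : ∀ a b c : A, dot (dot a b) c = dot a (dot b c))
    (h1 : ∀ a b c : A, circ (circ a b) c = circ a (circ b c + circ c b + dot b c))
    (h2 : ∀ a b c : A, circ (circ a b) c = circ (circ a c) b)
    (h3 : ∀ a b c : A, dot (circ a b) c = dot a (circ c b))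
    (h4 : ∀ a b c : A, circ (dot a b) c = dot (circ a c) b)
    (hD1 : ∀ a b : A, D (dot a b) = dot (D a) b + dot a (D b))
    (hD2 : ∀ a b : A, D (circ a b) = circ (D a) b + circ a (D b)) :
    IsPostNovikov (dot.compl₂ D) (circ.compl₂ D) ((circ ∘ₗ D).flip) := by
  have h1' (a b c : A) : circ (circ a b) c = circ a (circ b c) + circ a (circ c b) +
      circ a (dot b c) := by
    rw [h1, map_add, map_add]
  refine ⟨⟨fun a b c => ?_, fun a b c => ?_⟩, fun a b c => ?_, fun a b c => ?_, fun a b c => ?_,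
    fun a b c => ?_, fun a b c => ?_, fun a b c => ?_, fun a b c => ?_, fun a b c => ?_⟩ <;>
    simp only [LinearMap.compl₂_apply, LinearMap.flip_apply, LinearMap.comp_apply, map_add,
      LinearMap.add_apply, hD1, hD2]
  · rw [hassoc, ← hassoc a b, hassoc b, ← hassoc b a, hcomm b a]
    abel
  · rw [hassoc, hassoc, hcomm (D b)]
  · rw [h1']
    abel
  · rw [h2 (D c) (D b) a, h1' c (D a) (D b), h2 c (D (D b)) a, h1' c a (D (D b))]
    abel
  · have hab := h1' (D c) a (D b)
    have hba := h1' (D c) b (D a)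
    rw [h2 (D (D c)) b a, h2 (D c) (D b) a, h2 (D c) (D a) b, hab, hba]
    abel
  · exact h2 _ _ _
  · rw [h4, h4, h3 b a, h3 b (D a)]
    abel
  · rw [h4, h4, h3 b (D a), h3 c (D a), ← h3 b (D (D a)), ← h3 c (D (D a)), ← h4, ← h4, hcomm c b]
    abel
  · rw [h3, hcomm]
  · exact h4 _ _ _
end

section
/- Let (A, ∘, ◁, ▷) be a post-Novikov algebra and define a⊛b := a▷b + a◁b + a∘b. Then (A, ⊛) is a Novikov algebra (the associated Novikov algebra). Moreover, defining L▷(a)b := a▷b and R◁(b)a := a◁b, the quadruple (A, ∘, L▷, R◁) is an (A, ⊛)-bimodule Novikov algebra. -/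
open TensorProduct


/-- For a post-Novikov algebra `(A, ∘, ◁, ▷)`, the operation
`a ⊛ b := a▷b + a◁b + a∘b` is Novikov, and `(A, ∘, L▷, R◁)` is an
`(A, ⊛)`-bimodule Novikov algebra. -/
theorem postNovikov_associated_Novikov_and_bimodule
    {k : Type*} [Field k] [CharZero k]
    {A : Type*} [AddCommGroup A] [Module k A]
    (circ lhd rhd : A →ₗ[k] A →ₗ[k] A) (h : IsPostNovikov circ lhd rhd) :
    IsNovikov (rhd + lhd + circ) ∧
    IsBimoduleNovikovAlgebra (rhd + lhd + circ) circ rhd lhd.flip := by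
  obtain ⟨⟨hN, hN'⟩, h₁, h₂, h₃, h₄, h₅, h₆, h₇, h₈⟩ := h
  refine ⟨⟨fun a b c => ?_, fun a b c => ?_⟩, ⟨hN, hN'⟩, ⟨fun a b v => ?_, fun a b v => ?_,
    fun a b v => ?_, fun a b v => ?_⟩, fun a v w => ?_, fun a v w => ?_, fun a v w => ?_,
    fun a v w => ?_⟩
  · have e₁ := h₃ a b c
    have e₂ := h₂ a c b
    have e₃ := h₂ b c a
    have e₄ := h₅ a b c
    have e₅ := h₅ b a c
    have e₆ := h₆ c a b
    have e₇ := hN a b c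
    simp only [LinearMap.add_apply, map_add] at e₁ e₂ e₃ e₄ e₅ e₆ e₇ ⊢
    linear_combination (norm := abel) e₁ - e₂ + e₃ + e₄ - e₅ + e₆ + e₇
  · have e₁ := h₁ a b c
    have e₂ := h₁ a c b
    have e₃ := h₄ a b c
    have e₄ := h₇ a b c
    have e₅ := h₈ a b c
    have e₆ := h₈ a c b
    have e₇ := hN' a b c
    simp only [LinearMap.add_apply, map_add] at e₁ e₂ e₃ e₄ e₅ e₆ e₇ ⊢
    linear_combination (norm := abel) -e₁ + e₂ + e₃ + e₄ + e₅ - e₆ + e₇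
  · simpa only [LinearMap.add_apply, map_sub, LinearMap.sub_apply] using h₃ a b v
  · have e := h₂ a b v
    simp only [LinearMap.add_apply, LinearMap.flip_apply, map_add] at e ⊢
    linear_combination (norm := abel) e
  · exact (h₁ a b v).symm
  · exact h₄ v b a
  · exact h₅ a v w
  · exact h₆ a v w
  · exact h₇ a v w
  · exact h₈ v w a
end

section
/- Let (A, ∘) be a Novikov algebra, (M, ·, l, r) an A-bimodule Novikov algebra, λ ∈ k, and α : M → A an O-operator of weight λ on (A, ∘) associated to (M, ·, l, r). Define three bilinear operations on M by u⊙v := λ u·v, u▷v := l(α(u))v, and u◁v := r(α(v))u. Then (M, ⊙, ◁, ▷) is a post-Novikov algebra, and α is a Novikov algebra homomorphism from (M, ⊛) to (A, ∘), where u⊛v := u▷v + u◁v + u⊙v. -/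
open TensorProduct


/-- An O-operator `α` of weight `λ` induces a post-Novikov structure
`(M, ⊙, ◁, ▷)` with `u⊙v = λ u·v`, `u▷v = l(α(u))v`, `u◁v = r(α(v))u`, and `α` is a
Novikov algebra homomorphism from `(M, ⊛)` to `(A, ∘)`. -/
theorem oOperator_gives_postNovikov_and_hom
    {k : Type*} [Field k] [CharZero k]
    {A : Type*} [AddCommGroup A] [Module k A]
    {M : Type*} [AddCommGroup M] [Module k M]
    (mulA : A →ₗ[k] A →ₗ[k] A) (hA : IsNovikov mulA)
    (mulM : M →ₗ[k] M →ₗ[k] M) (l r : A →ₗ[k] Module.End k M)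
    (hM : IsBimoduleNovikovAlgebra mulA mulM l r)
    (lam : k) (α : M →ₗ[k] A) (hα : IsOOperator mulA mulM l r lam α) :
    IsPostNovikov (lam • mulM) ((r ∘ₗ α).flip) (l ∘ₗ α) ∧
    ∀ u v : M,
      α ((l ∘ₗ α) u v + (r ∘ₗ α).flip u v + (lam • mulM) u v) = mulA (α u) (α v) := by
  obtain ⟨⟨hassoc, hcomm⟩, ⟨hl, hlr, hrl, hrr⟩, hlM, hrM, hlM', hrM'⟩ := hM
  have hhom : ∀ u v : M,
      α ((l ∘ₗ α) u v + (r ∘ₗ α).flip u v + (lam • mulM) u v) = mulA (α u) (α v) :=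
    fun u v => (hα u v).symm
  have hhom' : ∀ u v : M,
      α ((r ∘ₗ α).flip u v + (l ∘ₗ α) u v + (lam • mulM) u v) = mulA (α u) (α v) :=
    fun u v => by rw [add_comm ((r ∘ₗ α).flip u v)]; exact hhom u v
  refine ⟨⟨⟨fun a b c => ?_, fun a b c => ?_⟩, fun a b c => ?_, fun a b c => ?_,
    fun a b c => ?_, fun a b c => ?_, fun a b c => ?_, fun a b c => ?_, fun a b c => ?_,
    fun a b c => ?_⟩, hhom⟩
  · simp only [LinearMap.smul_apply, map_smul, ← smul_sub, hassoc a b c]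
  · simp only [LinearMap.smul_apply, map_smul, hcomm a b c]
  · rw [LinearMap.comp_apply l α (_ + _ + _), hhom]
    exact (hrl (α a) (α b) c).symm
  · rw [LinearMap.flip_apply _ (_ + _ + _), LinearMap.comp_apply r α (_ + _ + _), hhom']
    exact eq_sub_iff_add_eq.mp (hlr (α a) (α b) c)
  · rw [LinearMap.comp_apply l α (_ + _ + _), LinearMap.comp_apply l α (_ + _ + _), hhom, hhom,
      ← LinearMap.sub_apply, ← map_sub]
    exact hl (α a) (α b) c
  · exact hrr (α c) (α b) a
  · simpa only [LinearMap.smul_apply, LinearMap.flip_apply, LinearMap.comp_apply, map_smul,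
      smul_sub] using congrArg (lam • ·) (hlM (α a) b c)
  · simpa only [LinearMap.smul_apply, LinearMap.flip_apply, LinearMap.comp_apply, map_smul,
      smul_sub] using congrArg (lam • ·) (hrM (α a) b c)
  · exact congrArg (lam • ·) (hlM' (α a) b c)
  · simpa only [LinearMap.smul_apply, LinearMap.flip_apply, LinearMap.comp_apply, map_smul] using
      congrArg (lam • ·) (hrM' (α c) a b)
end

section
/- Let (A, ∘) be a Novikov algebra, (M, ·, l, r) an A-bimodule Novikov algebra, λ ∈ k, and α : M → A an O-operator of weight λ on (A, ∘) associated to (M, ·, l, r). Suppose Ker(α) is an ideal of the Novikov algebra (M, ·). Then the formulas α(u)∘'α(v) := λ α(u·v), α(u)▷'α(v) := α(l(α(u))v), α(u)◁'α(v) := α(r(α(v))u) are well-defined bilinear operations on the subspace α(M) ⊆ A, (α(M), ∘', ◁', ▷') is a post-Novikov algebra, and α is a homomorphism of post-Novikov algebras from (M, ⊙, ◁, ▷) to (α(M), ∘', ◁', ▷'), where u⊙v := λ u·v, u▷v := l(α(u))v, u◁v := r(α(v))u. -/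
open TensorProduct


/-- A bilinear operation on the source of a surjective linear map descends to the target as soon as
the kernel absorbs it on both sides. -/
theorem exists_bilinear_descent {k M N : Type*} [Field k] [AddCommGroup M] [Module k M]
    [AddCommGroup N] [Module k N] (f : M →ₗ[k] N) (hf : Function.Surjective f)
    (B : M →ₗ[k] M →ₗ[k] M) (hleft : ∀ u v, f u = 0 → f (B u v) = 0)
    (hright : ∀ u v, f v = 0 → f (B u v) = 0) :
    ∃ B' : N →ₗ[k] N →ₗ[k] N, ∀ u v, B' (f u) (f v) = f (B u v) := by
  obtain ⟨s, hs⟩ := f.exists_rightInverse_of_surjective (LinearMap.range_eq_top.mpr hf)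
  have hfs : ∀ x, f (s x) = x := fun x => LinearMap.congr_fun hs x
  refine ⟨(B.compl₁₂ s s).compr₂ f, fun u v => ?_⟩
  have h₁ := hleft (s (f u) - u) (s (f v)) (by simp [hfs])
  have h₂ := hright u (s (f v) - v) (by simp [hfs])
  simp only [map_sub, LinearMap.sub_apply, sub_eq_zero] at h₁ h₂
  exact h₁.trans h₂

/-- The image of a post-Novikov algebra under a surjective homomorphism is post-Novikov. -/
theorem IsPostNovikov.of_surjective {k M N : Type*} [Field k] [AddCommGroup M] [Module k M]
    [AddCommGroup N] [Module k N] {circ lhd rhd : M →ₗ[k] M →ₗ[k] M}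
    {circ' lhd' rhd' : N →ₗ[k] N →ₗ[k] N} (h : IsPostNovikov circ lhd rhd)
    (f : M →ₗ[k] N) (hf : Function.Surjective f)
    (hcirc : ∀ u v, circ' (f u) (f v) = f (circ u v))
    (hlhd : ∀ u v, lhd' (f u) (f v) = f (lhd u v))
    (hrhd : ∀ u v, rhd' (f u) (f v) = f (rhd u v)) :
    IsPostNovikov circ' lhd' rhd' := by
  obtain ⟨⟨h₁, h₂⟩, h₃, h₄, h₅, h₆, h₇, h₈, h₉, h₁₀⟩ := h
  refine ⟨⟨?_, ?_⟩, ?_, ?_, ?_, ?_, ?_, ?_, ?_, ?_⟩ <;>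
    refine hf.forall₃.mpr fun a b c => ?_ <;>
    simp only [hcirc, hlhd, hrhd, ← map_add, ← map_sub] <;>
    apply congrArg f
  exacts [h₁ a b c, h₂ a b c, h₃ a b c, h₄ a b c, h₅ a b c, h₆ a b c, h₇ a b c, h₈ a b c,
    h₉ a b c, h₁₀ a b c]

/-- An O-operator `α : M → A` of weight `lam` turns `M` into a post-Novikov algebra with
`u ⊙ v = lam • u · v`, `u ◁ v = r (α v) u` and `u ▷ v = l (α u) v`. -/
theorem IsOOperator.isPostNovikov {k A M : Type*} [Field k] [CharZero k]
    [AddCommGroup A] [Module k A] [AddCommGroup M] [Module k M]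
    {mulA : A →ₗ[k] A →ₗ[k] A} {mulM : M →ₗ[k] M →ₗ[k] M} {l r : A →ₗ[k] Module.End k M}
    (hM : IsBimoduleNovikovAlgebra mulA mulM l r) {lam : k} {α : M →ₗ[k] A}
    (hα : IsOOperator mulA mulM l r lam α) :
    IsPostNovikov (lam • mulM) (r ∘ₗ α).flip (l ∘ₗ α) := by
  obtain ⟨⟨hN₁, hN₂⟩, ⟨hB₁, hB₂, hB₃, hB₄⟩, h₁, h₂, h₃, h₄⟩ := hM
  have hlr : ∀ u v, α (l (α u) v + r (α v) u + lam • mulM u v) = mulA (α u) (α v) :=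
    fun u v => (hα u v).symm
  have hrl : ∀ u v, α (r (α v) u + l (α u) v + lam • mulM u v) = mulA (α u) (α v) := fun u v => by
    rw [hα u v, add_comm (r (α v) u)]
  refine ⟨⟨fun a b c => ?_, fun a b c => ?_⟩, fun a b c => ?_, fun a b c => ?_, fun a b c => ?_,
    fun a b c => ?_, fun a b c => ?_, fun a b c => ?_, fun a b c => ?_, fun a b c => ?_⟩ <;>
    simp only [LinearMap.smul_apply, LinearMap.flip_apply, LinearMap.comp_apply, map_smul,
      hlr, hrl, ← smul_sub]
  · rw [hN₁]
  · rw [hN₂]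
  · rw [hB₃]
  · rw [hB₂]; abel
  · rw [← hB₁, map_sub, LinearMap.sub_apply]
  · rw [hB₄]
  · rw [h₁]
  · rw [h₂]
  · rw [h₃]
  · rw [h₄]

/-- If `Ker α` is an ideal of `(M, ·)`, the induced operations on
`α(M)` are well defined, give a post-Novikov algebra, and `α` is a homomorphism of
post-Novikov algebras from `(M, ⊙, ◁, ▷)` onto it. -/
theorem oOperator_induced_postNovikov_on_image
    {k : Type*} [Field k] [CharZero k]
    {A : Type*} [AddCommGroup A] [Module k A]
    {M : Type*} [AddCommGroup M] [Module k M]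
    (mulA : A →ₗ[k] A →ₗ[k] A) (hA : IsNovikov mulA)
    (mulM : M →ₗ[k] M →ₗ[k] M) (l r : A →ₗ[k] Module.End k M)
    (hM : IsBimoduleNovikovAlgebra mulA mulM l r)
    (lam : k) (α : M →ₗ[k] A) (hα : IsOOperator mulA mulM l r lam α)
    (hker : ∀ u ∈ LinearMap.ker α, ∀ v : M,
      mulM u v ∈ LinearMap.ker α ∧ mulM v u ∈ LinearMap.ker α) :
    ∃ circ' lhd' rhd' :
        ↥(LinearMap.range α) →ₗ[k] ↥(LinearMap.range α) →ₗ[k] ↥(LinearMap.range α),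
      (∀ u v : M,
        (circ' ⟨α u, LinearMap.mem_range_self α u⟩ ⟨α v, LinearMap.mem_range_self α v⟩ : A)
          = α (lam • mulM u v)) ∧
      (∀ u v : M,
        (rhd' ⟨α u, LinearMap.mem_range_self α u⟩ ⟨α v, LinearMap.mem_range_self α v⟩ : A)
          = α (l (α u) v)) ∧
      (∀ u v : M,
        (lhd' ⟨α u, LinearMap.mem_range_self α u⟩ ⟨α v, LinearMap.mem_range_self α v⟩ : A)
          = α (r (α v) u)) ∧
      IsPostNovikov circ' lhd' rhd' := by
  have hl : ∀ u v, α v = 0 → α (l (α u) v) = 0 := fun u v hv => by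
    simpa [hv, LinearMap.mem_ker.mp (hker v hv u).2] using (hα u v).symm
  have hr : ∀ u v, α u = 0 → α (r (α v) u) = 0 := fun u v hu => by
    simpa [hu, LinearMap.mem_ker.mp (hker u hu v).1] using (hα u v).symm
  have hzero : ∀ w, α.rangeRestrict w = 0 ↔ α w = 0 := fun w => Subtype.ext_iff
  obtain ⟨circ', hcirc⟩ := exists_bilinear_descent α.rangeRestrict α.surjective_rangeRestrict
    (lam • mulM)
    (fun u v hu => by
      rw [hzero] at hu ⊢
      simp [LinearMap.mem_ker.mp (hker u hu v).1])
    (fun u v hv => by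
      rw [hzero] at hv ⊢
      simp [LinearMap.mem_ker.mp (hker v hv u).2])
  obtain ⟨lhd', hlhd⟩ := exists_bilinear_descent α.rangeRestrict α.surjective_rangeRestrict
    (r ∘ₗ α).flip
    (fun u v hu => by
      rw [hzero] at hu ⊢
      exact hr u v hu)
    (fun u v hv => by
      rw [hzero] at hv ⊢
      simp [hv])
  obtain ⟨rhd', hrhd⟩ := exists_bilinear_descent α.rangeRestrict α.surjective_rangeRestrict
    (l ∘ₗ α)
    (fun u v hu => by
      rw [hzero] at hu ⊢
      simp [hu])
    (fun u v hv => by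
      rw [hzero] at hv ⊢
      exact hl u v hv)
  exact ⟨circ', lhd', rhd', fun u v => congrArg Subtype.val (hcirc u v),
    fun u v => congrArg Subtype.val (hrhd u v), fun u v => congrArg Subtype.val (hlhd u v),
    (IsOOperator.isPostNovikov hM hα).of_surjective α.rangeRestrict α.surjective_rangeRestrict
      hcirc hlhd hrhd⟩
end

section
/- Let (A, ·) be a Novikov algebra. Then there is a compatible post-Novikov algebra structure on A (i.e. a post-Novikov algebra (A, ∘, ◁, ▷) with a▷b + a◁b + a∘b = a·b for all a, b ∈ A) if and only if there exist an A-bimodule Novikov algebra (M, ·_M, l, r) over (A, ·) and an invertible O-operator of weight 1 on (A, ·) associated to (M, ·_M, l, r). -/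
open TensorProduct


universe u

section Correspondence

variable {k : Type*} [Field k]
variable {A : Type*} [AddCommGroup A] [Module k A]
variable {M : Type*} [AddCommGroup M] [Module k M]

/-- The left action of a post-Novikov algebra is `▷` and the right action is `◁` flipped. -/
theorem IsPostNovikov.isBimoduleNovikovAlgebra {mulA circ lhd rhd : A →ₗ[k] A →ₗ[k] A}
    (h : IsPostNovikov circ lhd rhd)
    (hmul : ∀ a b : A, rhd a b + lhd a b + circ a b = mulA a b) :
    IsBimoduleNovikovAlgebra mulA circ rhd lhd.flip := by
  obtain ⟨hc, h1, h2, h3, h4, h5, h6, h7, h8⟩ := h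
  simp only [add_comm (lhd _ _) (rhd _ _), hmul] at h1 h2 h3
  refine ⟨hc, ⟨fun a b v => ?_, fun a b v => ?_, fun a b v => (h1 a b v).symm,
    fun a b v => h4 v b a⟩, h5, fun a v w => h6 a v w, h7, fun a v w => h8 v w a⟩
  · rw [map_sub, LinearMap.sub_apply]
    exact h3 a b v
  · rw [LinearMap.flip_apply, LinearMap.flip_apply, LinearMap.flip_apply, LinearMap.flip_apply,
      LinearMap.flip_apply, ← h2 a b v]
    abel

/-- Transporting the product and the two actions along an invertible `O`-operator of weight `1`
gives a compatible post-Novikov structure. -/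
theorem IsBimoduleNovikovAlgebra.isPostNovikov_of_equiv {mulA : A →ₗ[k] A →ₗ[k] A}
    {mulM : M →ₗ[k] M →ₗ[k] M} {l r : A →ₗ[k] Module.End k M}
    (h : IsBimoduleNovikovAlgebra mulA mulM l r) (e : M ≃ₗ[k] A)
    {circ lhd rhd : A →ₗ[k] A →ₗ[k] A}
    (hcirc : ∀ a b, circ a b = e (mulM (e.symm a) (e.symm b)))
    (hlhd : ∀ a b, lhd a b = e (r b (e.symm a)))
    (hrhd : ∀ a b, rhd a b = e (l a (e.symm b)))
    (hmul : ∀ a b : A, rhd a b + lhd a b + circ a b = mulA a b) :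
    IsPostNovikov circ lhd rhd := by
  obtain ⟨⟨n1, n2⟩, ⟨b1, b2, b3, b4⟩, c1, c2, c3, c4⟩ := h
  have key : ∀ {x y : M}, x = y → e x = e y := fun hxy => congrArg e hxy
  unfold IsPostNovikov IsNovikov
  simp only [add_comm (lhd _ _) (rhd _ _), hmul]
  simp only [hcirc, hlhd, hrhd, LinearEquiv.symm_apply_apply, ← map_sub, ← map_add]
  refine ⟨⟨fun a b c => key (n1 _ _ _), fun a b c => key (n2 _ _ _)⟩,
    fun a b c => key (b3 _ _ _).symm, fun a b c => key ?_, fun a b c => ?_,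
    fun a b c => key (b4 _ _ _), fun a b c => key (c1 _ _ _), fun a b c => key (c2 _ _ _),
    fun a b c => key (c3 _ _ _), fun a b c => key (c4 _ _ _)⟩
  · rw [b2, sub_add_cancel]
  · rw [← b1, map_sub l, LinearMap.sub_apply]

end Correspondence

/-- A Novikov algebra `(A, ·)` has a compatible post-Novikov structure
iff there is an `A`-bimodule Novikov algebra together with an invertible O-operator of
weight `1`. -/
theorem compatible_postNovikov_iff_invertible_oOperator
    {k : Type*} [Field k] [CharZero k]
    {A : Type u} [AddCommGroup A] [Module k A]
    (mulA : A →ₗ[k] A →ₗ[k] A) (hA : IsNovikov mulA) :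
    (∃ circ lhd rhd : A →ₗ[k] A →ₗ[k] A, IsPostNovikov circ lhd rhd ∧
        ∀ a b : A, rhd a b + lhd a b + circ a b = mulA a b) ↔
    (∃ (M : Type u) (_ : AddCommGroup M) (_ : Module k M)
        (mulM : M →ₗ[k] M →ₗ[k] M) (l r : A →ₗ[k] Module.End k M) (α : M →ₗ[k] A),
        IsBimoduleNovikovAlgebra mulA mulM l r ∧
        IsOOperator mulA mulM l r 1 α ∧ Function.Bijective α) := by
  constructor
  · rintro ⟨circ, lhd, rhd, h, hmul⟩
    refine ⟨A, inferInstance, inferInstance, circ, rhd, lhd.flip, LinearMap.id,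
      h.isBimoduleNovikovAlgebra hmul, fun u v => ?_, Function.bijective_id⟩
    rw [one_smul]
    exact (hmul u v).symm
  · rintro ⟨M, _, _, mulM, l, r, α, h, hα, hbij⟩
    let e : M ≃ₗ[k] A := LinearEquiv.ofBijective α hbij
    have hmul : ∀ a b : A, e (l a (e.symm b)) + e (r b (e.symm a))
        + e (mulM (e.symm a) (e.symm b)) = mulA a b := by
      have hO : ∀ u v : M, mulA (e u) (e v) = e (l (e u) v + r (e v) u + (1 : k) • mulM u v) := hα
      intro a b
      simpa using (hO (e.symm a) (e.symm b)).symm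
    let circ : A →ₗ[k] A →ₗ[k] A :=
      LinearMap.mk₂ k (fun a b => e (mulM (e.symm a) (e.symm b)))
        (by simp) (by simp) (by simp) (by simp)
    let lhd : A →ₗ[k] A →ₗ[k] A :=
      LinearMap.mk₂ k (fun a b => e (r b (e.symm a))) (by simp) (by simp) (by simp) (by simp)
    let rhd : A →ₗ[k] A →ₗ[k] A :=
      LinearMap.mk₂ k (fun a b => e (l a (e.symm b))) (by simp) (by simp) (by simp) (by simp)
    exact ⟨circ, lhd, rhd, h.isPostNovikov_of_equiv e (fun _ _ => rfl) (fun _ _ => rfl)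
      (fun _ _ => rfl) hmul, hmul⟩
end

section
/- Let (A, ∘) be a Novikov algebra and T : A → A a Rota-Baxter operator of weight λ. Then the operations x⊙y := λ x∘y, x▷y := T(x)∘y, x◁y := x∘T(y) make (A, ⊙, ◁, ▷) a post-Novikov algebra. If in addition T is invertible, then the operations x∘_T y := λ T(T⁻¹(x)∘T⁻¹(y)), x▷_T y := T(x∘T⁻¹(y)), x◁_T y := T(T⁻¹(x)∘y) form a compatible post-Novikov algebra structure on (A, ∘), i.e. (A, ∘_T, ◁_T, ▷_T) is a post-Novikov algebra with x▷_T y + x◁_T y + x∘_T y = x∘y for all x, y. -/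
open TensorProduct


/-- An injective linear map intertwining the operations reflects the Novikov axioms. -/
theorem IsNovikov.of_injective {k A B : Type*} [Field k]
    [AddCommGroup A] [Module k A] [AddCommGroup B] [Module k B]
    {mul : A →ₗ[k] A →ₗ[k] A} {mul' : B →ₗ[k] B →ₗ[k] B} (h : IsNovikov mul)
    (S : B →ₗ[k] A) (hS : Function.Injective S)
    (hmul : ∀ x y, S (mul' x y) = mul (S x) (S y)) : IsNovikov mul' := by
  refine ⟨fun a b c => hS ?_, fun a b c => hS ?_⟩ <;> simp only [map_sub, hmul]
  · exact h.1 _ _ _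
  · exact h.2 _ _ _

/-- An injective linear map intertwining the operations reflects the post-Novikov axioms. -/
theorem IsPostNovikov.of_injective {k A B : Type*} [Field k]
    [AddCommGroup A] [Module k A] [AddCommGroup B] [Module k B]
    {circ lhd rhd : A →ₗ[k] A →ₗ[k] A} {circ' lhd' rhd' : B →ₗ[k] B →ₗ[k] B}
    (h : IsPostNovikov circ lhd rhd) (S : B →ₗ[k] A) (hS : Function.Injective S)
    (hcirc : ∀ x y, S (circ' x y) = circ (S x) (S y))
    (hlhd : ∀ x y, S (lhd' x y) = lhd (S x) (S y))
    (hrhd : ∀ x y, S (rhd' x y) = rhd (S x) (S y)) :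
    IsPostNovikov circ' lhd' rhd' := by
  obtain ⟨h0, h1, h2, h3, h4, h5, h6, h7, h8⟩ := h
  refine ⟨h0.of_injective S hS hcirc, ?_, ?_, ?_, ?_, ?_, ?_, ?_, ?_⟩ <;>
    intro a b c <;> apply hS <;>
    simp only [map_sub, LinearMap.map_add S, hcirc, hlhd, hrhd]
  · exact h1 _ _ _
  · exact h2 _ _ _
  · exact h3 _ _ _
  · exact h4 _ _ _
  · exact h5 _ _ _
  · exact h6 _ _ _
  · exact h7 _ _ _
  · exact h8 _ _ _

/-- The operations `λ x∘y`, `x∘T(y)`, `T(x)∘y` attached to a Rota-Baxter operator form a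
post-Novikov algebra. -/
theorem IsRotaBaxter.isPostNovikov {k A : Type*} [Field k] [AddCommGroup A] [Module k A]
    {mulA : A →ₗ[k] A →ₗ[k] A} (hA : IsNovikov mulA)
    {lam : k} {T : A →ₗ[k] A} (hT : IsRotaBaxter mulA lam T) :
    IsPostNovikov (lam • mulA) (mulA.compl₂ T) (mulA ∘ₗ T) := by
  obtain ⟨hl, hr⟩ := hA
  have hT₁ (x y : A) :
      T (mulA (T x) y + mulA x (T y) + lam • mulA x y) = mulA (T x) (T y) := (hT x y).symm
  have hT₂ (x y : A) :
      T (mulA x (T y) + mulA (T x) y + lam • mulA x y) = mulA (T x) (T y) := by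
    rw [hT x y, add_comm (mulA x (T y))]
  refine ⟨⟨fun a b c => ?_, fun a b c => ?_⟩, fun a b c => ?_, fun a b c => ?_, fun a b c => ?_,
    fun a b c => ?_, fun a b c => ?_, fun a b c => ?_, fun a b c => ?_, fun a b c => ?_⟩ <;>
    simp only [LinearMap.smul_apply, LinearMap.compl₂_apply, LinearMap.comp_apply, hT₁, hT₂,
      map_smul, ← smul_sub]
  · rw [hl a b c]
  · rw [hr a b c]
  · exact hr _ _ _
  · rw [← sub_eq_zero, ← sub_eq_zero.mpr (hl c (T a) (T b))]
    abel
  · rw [sub_eq_sub_iff_sub_eq_sub]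
    exact hl _ _ _
  · exact hr _ _ _
  · rw [hl]
  · rw [hl]
  · rw [hr]
  · rw [hr]

/-- A Rota-Baxter operator `T` of weight `λ` on `(A, ∘)` yields a
post-Novikov algebra `(A, ⊙, ◁, ▷)` with `x⊙y = λ x∘y`, `x▷y = T(x)∘y`, `x◁y = x∘T(y)`;
and if `T` is invertible (with inverse `S`), the transported operations give a compatible
post-Novikov structure on `(A, ∘)`. -/
theorem rotaBaxter_gives_postNovikov
    {k : Type*} [Field k] [CharZero k]
    {A : Type*} [AddCommGroup A] [Module k A]
    (mulA : A →ₗ[k] A →ₗ[k] A) (hA : IsNovikov mulA)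
    (lam : k) (T : A →ₗ[k] A) (hT : IsRotaBaxter mulA lam T) :
    IsPostNovikov (lam • mulA) (mulA.compl₂ T) (mulA ∘ₗ T) ∧
    (∀ S : A →ₗ[k] A, S ∘ₗ T = LinearMap.id → T ∘ₗ S = LinearMap.id →
      IsPostNovikov (lam • (((mulA ∘ₗ S).compl₂ S).compr₂ T))
        ((mulA ∘ₗ S).compr₂ T) ((mulA.compl₂ S).compr₂ T) ∧
      ∀ x y : A,
        ((mulA.compl₂ S).compr₂ T) x y + ((mulA ∘ₗ S).compr₂ T) x y
          + (lam • (((mulA ∘ₗ S).compl₂ S).compr₂ T)) x y = mulA x y) := by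
  refine ⟨hT.isPostNovikov hA, fun S hST hTS => ?_⟩
  have hS (x : A) : S (T x) = x := LinearMap.congr_fun hST x
  have hT' (x : A) : T (S x) = x := LinearMap.congr_fun hTS x
  refine ⟨(hT.isPostNovikov hA).of_injective S (Function.LeftInverse.injective hT')
    (fun x y => ?_) (fun x y => ?_) (fun x y => ?_), fun x y => ?_⟩
  · simp [hS]
  · simp [hS, hT']
  · simp [hS, hT']
  · simpa [hT', add_comm, add_left_comm] using (hT (S x) (S y)).symm
end

section
/- Let (A, ∘) be a Novikov algebra, (M, ·, l, r) an A-bimodule Novikov algebra, α : M → A a linear map and λ ∈ k. Define u∗v := l(α(u))v + r(α(v))u + λ u·v on M. Then (M, ∗) is a Novikov algebra if and only if for all u, v, w ∈ M: (1) l(α(u∗v) − α(u)∘α(v))w = l(α(u∗w) − α(u)∘α(w))v, and (2) l(α(u∗v) − α(u)∘α(v))w − l(α(v∗u) − α(v)∘α(u))w = r(α(v∗w) − α(v)∘α(w))u − r(α(u∗w) − α(u)∘α(w))v. -/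
open TensorProduct


/-- The operation `u∗v = l(α(u))v + r(α(v))u + λ u·v` is Novikov iff the
two compatibility conditions on `α` hold. -/
theorem starMul_isNovikov_iff
    {k : Type*} [Field k] [CharZero k]
    {A : Type*} [AddCommGroup A] [Module k A]
    {M : Type*} [AddCommGroup M] [Module k M]
    (mulA : A →ₗ[k] A →ₗ[k] A) (hA : IsNovikov mulA)
    (mulM : M →ₗ[k] M →ₗ[k] M) (l r : A →ₗ[k] Module.End k M)
    (hM : IsBimoduleNovikovAlgebra mulA mulM l r)
    (α : M →ₗ[k] A) (lam : k)
    (star : M →ₗ[k] M →ₗ[k] M)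
    (hstar : ∀ u v : M, star u v = l (α u) v + r (α v) u + lam • mulM u v) :
    IsNovikov star ↔
      ((∀ u v w : M,
          l (α (star u v) - mulA (α u) (α v)) w = l (α (star u w) - mulA (α u) (α w)) v) ∧
       (∀ u v w : M,
          l (α (star u v) - mulA (α u) (α v)) w - l (α (star v u) - mulA (α v) (α u)) w
            = r (α (star v w) - mulA (α v) (α w)) u
              - r (α (star u w) - mulA (α u) (α w)) v)) := by
  obtain ⟨⟨mulM_leftSymm, mulM_rightComm⟩, ⟨l_comm, lr_comm, l_mul, r_comm⟩,
    mul_l, r_mul_swap, l_mul_swap, r_mul⟩ := hM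
  have star_star_left : ∀ u v w, star (star u v) w = l (α (star u v)) w
      + r (α w) (l (α u) v + r (α v) u + lam • mulM u v)
      + lam • mulM (l (α u) v + r (α v) u + lam • mulM u v) w := by
    intro u v w
    rw [← hstar u v, ← hstar (star u v) w]
  have star_star_right : ∀ u v w, star u (star v w)
      = l (α u) (l (α v) w + r (α w) v + lam • mulM v w) + r (α (star v w)) u
      + lam • mulM u (l (α v) w + r (α w) v + lam • mulM v w) := by
    intro u v w
    rw [← hstar v w, ← hstar u (star v w)]
  have rightComm_defect : ∀ u v w, star (star u v) w - star (star u w) v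
      = l (α (star u v) - mulA (α u) (α v)) w - l (α (star u w) - mulA (α u) (α w)) v := by
    intro u v w
    rw [star_star_left, star_star_left]
    simp only [map_add, map_sub, map_smul, LinearMap.add_apply, LinearMap.sub_apply,
      LinearMap.smul_apply]
    linear_combination (norm := module) r_comm (α w) (α v) u - l_mul (α u) (α w) v
      + l_mul (α u) (α v) w + lam • l_mul_swap (α u) v w + lam • r_mul (α w) u v
      - lam • r_mul (α v) u w + (lam * lam) • mulM_rightComm u v w
  have leftSymm_defect : ∀ u v w,
      (star (star u v) w - star u (star v w)) - (star (star v u) w - star v (star u w))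
      = (l (α (star u v) - mulA (α u) (α v)) w - l (α (star v u) - mulA (α v) (α u)) w)
        - (r (α (star v w) - mulA (α v) (α w)) u - r (α (star u w) - mulA (α u) (α w)) v) := by
    intro u v w
    rw [star_star_left, star_star_left, star_star_right, star_star_right]
    have l_comm_uv := l_comm (α u) (α v) w
    simp only [map_add, map_sub, map_smul, LinearMap.add_apply, LinearMap.sub_apply,
      LinearMap.smul_apply] at l_comm_uv ⊢
    linear_combination (norm := module) l_comm_uv - lr_comm (α u) (α w) v
      + lr_comm (α v) (α w) u + lam • mul_l (α u) v w - lam • mul_l (α v) u w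
      + lam • r_mul_swap (α w) u v + (lam * lam) • mulM_leftSymm u v w
  constructor
  · rintro ⟨hl, hr⟩
    refine ⟨fun u v w => ?_, fun u v w => ?_⟩
    · rw [← sub_eq_zero, ← rightComm_defect, sub_eq_zero]
      exact hr u v w
    · rw [← sub_eq_zero, ← leftSymm_defect, sub_eq_zero]
      exact hl u v w
  · rintro ⟨hr, hl⟩
    refine ⟨fun u v w => ?_, fun u v w => ?_⟩
    · rw [← sub_eq_zero, leftSymm_defect, sub_eq_zero]
      exact hl u v w
    · rw [← sub_eq_zero, rightComm_defect, sub_eq_zero]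
      exact hr u v w
end

section
/- Let (A, ∘) be a Novikov algebra, (M, ·, l, r) an A-bimodule Novikov algebra, λ, κ, μ ∈ k, and suppose α : M → A is an extended O-operator of weight λ with extension β of mass (κ, μ) on (A, ∘) associated to (M, ·, l, r). Then (M, ∗) with u∗v := l(α(u))v + r(α(v))u + λ u·v is a Novikov algebra. -/
open TensorProduct


/-- If `α` is an extended O-operator of weight `λ` with extension `β` of
mass `(κ, μ)`, then `u∗v = l(α(u))v + r(α(v))u + λ u·v` is a Novikov product on `M`. -/
theorem extendedOOperator_starMul_isNovikov
    {k : Type*} [Field k] [CharZero k]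
    {A : Type*} [AddCommGroup A] [Module k A]
    {M : Type*} [AddCommGroup M] [Module k M]
    (mulA : A →ₗ[k] A →ₗ[k] A) (hA : IsNovikov mulA)
    (mulM : M →ₗ[k] M →ₗ[k] M) (l r : A →ₗ[k] Module.End k M)
    (hM : IsBimoduleNovikovAlgebra mulA mulM l r)
    (lam κ μ : k) (α β : M →ₗ[k] A)
    (hα : IsExtendedOOperator mulA mulM l r lam κ μ α β)
    (star : M →ₗ[k] M →ₗ[k] M)
    (hstar : ∀ u v : M, star u v = l (α u) v + r (α v) u + lam • mulM u v) :
    IsNovikov star := by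
  obtain ⟨⟨hm₁, hm₂⟩, ⟨hb₁, hb₂, hb₃, hb₄⟩, hc₁, hc₂, hc₃, hc₄⟩ := hM
  obtain ⟨hbal, ⟨hinv, -⟩, ⟨heq₁, heq₂⟩, hext⟩ := hα
  have hαstar (u v : M) :
      α (star u v) = mulA (α u) (α v) - κ • mulA (β u) (β v) - μ • β (mulM u v) := by
    rw [hstar, sub_sub, ← hext u v, sub_sub_cancel]
  have hl (u v w : M) : l (α (star u v)) w =
      l (mulA (α u) (α v)) w - κ • l (mulA (β u) (β v)) w - μ • l (β (mulM u v)) w := by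
    simp [hαstar]
  have hr (u v w : M) : r (α (star v w)) u =
      r (mulA (α v) (α w)) u - κ • r (mulA (β v) (β w)) u - μ • r (β (mulM v w)) u := by
    simp [hαstar]
  have hassoc (u v w : M) : star (star u v) w = l (α (star u v)) w +
      (r (α w) (l (α u) v) + r (α w) (r (α v) u) + lam • r (α w) (mulM u v)) +
      lam • (mulM (l (α u) v) w + mulM (r (α v) u) w + lam • mulM (mulM u v) w) := by
    rw [hstar (star u v) w, hstar u v]
    simp
  have hassoc' (u v w : M) : star u (star v w) =
      (l (α u) (l (α v) w) + l (α u) (r (α w) v) + lam • l (α u) (mulM v w)) +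
      r (α (star v w)) u +
      lam • (mulM u (l (α v) w) + mulM u (r (α w) v) + lam • mulM u (mulM v w)) := by
    rw [hstar u (star v w), hstar v w]
    simp
  have hcomm (a b : A) (v : M) : l (mulA a b) v - l (mulA b a) v = l a (l b v) - l b (l a v) := by
    simpa using hb₁ a b v
  have hκ (u v w : M) : κ • r (mulA (β v) (β w)) u = κ • l (β u) (l (β v) w) := by
    rw [hbal, ← LinearMap.smul_apply, ← map_smul, hinv, map_smul, LinearMap.smul_apply]
  have hμ (u v w : M) : μ • r (β (mulM v w)) u = μ • mulM u (l (β v) w) := by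
    rw [heq₂, hbal]
  refine ⟨fun u v w => ?_, fun u v w => ?_⟩
  · have hβ : μ • l (β u) (mulM v w) = μ • mulM u (l (β v) w) := by
      rw [hbal, hμ]
    rw [hassoc, hassoc, hassoc', hassoc', hl, hl, hr, hr, hκ, hκ, hμ, hμ, heq₁, heq₁]
    have hc := hc₁ (β u) v w
    rw [← hbal v u] at hc
    linear_combination (norm := module) hcomm (α u) (α v) w - κ • hcomm (β u) (β v) w
      - hb₂ (α u) (α w) v + hb₂ (α v) (α w) u
      + lam • hc₁ (α u) v w - lam • hc₁ (α v) u w + lam • hc₂ (α w) u v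
      + (lam * lam) • hm₁ u v w - μ • hc - hβ
  · have hβ : l (mulA (β u) (β v)) w = l (mulA (β u) (β w)) v := by
      rw [hb₃, hb₃, hbal u w, hbal u v, hb₄]
    rw [hassoc, hassoc, hl, hl, heq₁, heq₁]
    linear_combination (norm := module) hb₃ (α u) (α v) w - hb₃ (α u) (α w) v
      + hb₄ (α w) (α v) u + lam • hc₄ (α w) u v - lam • hc₄ (α v) u w
      + lam • hc₃ (α u) v w + (lam * lam) • hm₂ u v w - κ • hβ - μ • hc₃ (β u) v w
end

section
/- Let (A, ∘) be a Novikov algebra, (M, ·, l, r) an A-bimodule Novikov algebra, λ ∈ k, and α, β : M → A linear maps, where β is an A-bimodule homomorphism from (M, l, r) to (A, L_A, R_A) (i.e. β(l(x)u) = x∘β(u) and β(r(x)u) = β(u)∘x for all x ∈ A, u ∈ M). Define u∗v := l(α(u))v + r(α(v))u + λ u·v. Then, for either choice of sign ±, the identity α(u)∘α(v) − α(l(α(u))v + r(α(v))u + λ u·v) = −β(u)∘β(v) ± λ β(u·v) holds for all u, v ∈ M if and only if (α ± β)(u)∘(α ± β)(v) = (α ± β)(u∗v) for all u, v ∈ M.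 -/
open TensorProduct


/-- For `β` an `A`-bimodule homomorphism, `α` satisfies the extended
identity with `(κ, μ) = (−1, ±λ)` iff `α ± β` intertwines `∗` with `∘`. -/
theorem extended_identity_iff_alpha_pm_beta_multiplicative
    {k : Type*} [Field k] [CharZero k]
    {A : Type*} [AddCommGroup A] [Module k A]
    {M : Type*} [AddCommGroup M] [Module k M]
    (mulA : A →ₗ[k] A →ₗ[k] A) (hA : IsNovikov mulA)
    (mulM : M →ₗ[k] M →ₗ[k] M) (l r : A →ₗ[k] Module.End k M)
    (hM : IsBimoduleNovikovAlgebra mulA mulM l r)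
    (lam : k) (α β : M →ₗ[k] A)
    (hβ : IsBimoduleHom mulA l r β)
    (ε : k) (hε : ε = 1 ∨ ε = -1)
    (star : M →ₗ[k] M →ₗ[k] M)
    (hstar : ∀ u v : M, star u v = l (α u) v + r (α v) u + lam • mulM u v) :
    (∀ u v : M,
        mulA (α u) (α v) - α (l (α u) v + r (α v) u + lam • mulM u v)
          = - mulA (β u) (β v) + (ε * lam) • β (mulM u v)) ↔
    (∀ u v : M, mulA ((α + ε • β) u) ((α + ε • β) v) = (α + ε • β) (star u v)) := by
  have hεε : ε * ε = 1 := by rcases hε with rfl | rfl <;> norm_num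
  refine forall₂_congr fun u v => ?_
  rw [← hstar, ← sub_eq_zero, ← sub_eq_zero (a := mulA ((α + ε • β) u) ((α + ε • β) v))]
  have hβstar : β (star u v) =
      mulA (α u) (β v) + mulA (β u) (α v) + lam • β (mulM u v) := by
    rw [hstar, map_add, map_add, map_smul, hβ.1, hβ.2]
  have hdiff : mulA (α u) (α v) - α (star u v)
        - (-mulA (β u) (β v) + (ε * lam) • β (mulM u v)) =
      mulA ((α + ε • β) u) ((α + ε • β) v) - (α + ε • β) (star u v) := by
    simp only [LinearMap.add_apply, LinearMap.smul_apply, map_add, map_smul, hβstar,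
      smul_add, smul_smul, hεε, one_smul]
    abel
  rw [hdiff]
end

section
/- Let (A, ∘) be a Novikov algebra, (M, ·, l, r) an A-bimodule Novikov algebra, λ ∈ k, and β : M → A a linear map which is balanced, A-invariant of mass κ ≠ 0, and equivalent of mass λ. Define new bilinear operations on M by u ·₊ v := λ u·v − 2 l(β(u))v and u ·₋ v := λ u·v + 2 l(β(u))v. Then (M, ·₊) and (M, ·₋) are Novikov algebras, and (M, ·₊, l, r) and (M, ·₋, l, r) are A-bimodule Novikov algebras. -/
open TensorProduct


/-- For a balanced `A`-invariant `β` which is equivalent of mass `lam`, every combination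
`lam u·v + c l(β(u))v` makes `(M, l, r)` an `A`-bimodule Novikov algebra. -/
theorem IsBimoduleNovikovAlgebra.of_twist
    {k : Type*} [Field k]
    {A : Type*} [AddCommGroup A] [Module k A]
    {M : Type*} [AddCommGroup M] [Module k M]
    {mulA : A →ₗ[k] A →ₗ[k] A}
    {mulM : M →ₗ[k] M →ₗ[k] M} {l r : A →ₗ[k] Module.End k M}
    (hM : IsBimoduleNovikovAlgebra mulA mulM l r)
    {lam κ : k} (hκ : κ ≠ 0) {β : M →ₗ[k] A}
    (hbal : IsBalanced l r β)
    (hinv : IsAInvariant mulA l r κ β)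
    (heqv : IsEquivalentOfMass mulM l r lam β)
    (c : k) {mul : M →ₗ[k] M →ₗ[k] M}
    (hmul : ∀ u v : M, mul u v = lam • mulM u v + c • l (β u) v) :
    IsBimoduleNovikovAlgebra mulA mul l r := by
  obtain ⟨⟨hlsymm, hrcomm⟩, ⟨hb1, hb2, hb3, hb4⟩, h1, h2, h3, h4⟩ := hM
  have hβl (x : A) (u : M) : β (l x u) = mulA x (β u) :=
    (smul_right_injective A hκ (hinv.1 x u)).symm
  have hβr (x : A) (u : M) : β (r x u) = mulA (β u) x :=
    (smul_right_injective A hκ (hinv.2 x u)).symm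
  have heq1 := heqv.1
  have heq2 (u v w : M) : lam • l (β u) (mulM v w) = lam • mulM u (l (β v) w) := by
    rw [hbal, hbal, heqv.2]
  -- the product `u * v = l (β u) v` alone satisfies the bimodule algebra identities
  have s1 (a : A) (v w : M) :
      l (β (l a v)) w - l a (l (β v) w) = l (β (r a v)) w - l (β v) (l a w) := by
    have h := hb1 a (β v) w
    rw [map_sub, LinearMap.sub_apply, ← hβl, ← hβr] at h
    linear_combination (norm := module) h
  have s2 (a : A) (v w : M) :
      r a (l (β v) w) - l (β v) (r a w) = r a (l (β w) v) - l (β w) (r a v) := by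
    have h := hb2 (β v) a w
    rw [← hβr, ← hbal w (r a v), ← hbal w v] at h
    linear_combination (norm := module) -h
  have s3 (a : A) (v w : M) : l (β (l a v)) w = l (β (l a w)) v := by
    rw [hβl, hb3, hbal]
  have s4 (a : A) (v w : M) : r a (l (β v) w) = l (β (r a v)) w := by
    rw [hβr, hb3]
  refine ⟨⟨fun u v w => ?_, fun u v w => ?_⟩, ⟨hb1, hb2, hb3, hb4⟩, fun a v w => ?_,
    fun a v w => ?_, fun a v w => ?_, fun a v w => ?_⟩ <;>
    simp only [hmul, map_add, map_smul, LinearMap.add_apply, LinearMap.smul_apply]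
  · have hd := h1 (β u) v w
    have hs := s1 (β u) v w
    rw [← hbal v u] at hd hs
    linear_combination (norm := module) (lam * lam) • hlsymm u v w + (2 * lam * c) • hd
      + (c * c) • hs + c • heq1 u v w - c • heq1 v u w + c • heq2 u v w + c • heq2 v u w
  · linear_combination (norm := module) (lam * lam) • hrcomm u v w + (2 * lam * c) • h3 (β u) v w
      + (c * c) • s3 (β u) v w + c • heq1 u v w - c • heq1 u w v
  · linear_combination (norm := module) lam • h1 a v w + c • s1 a v w
  · linear_combination (norm := module) lam • h2 a v w + c • s2 a v w
  · linear_combination (norm := module) lam • h3 a v w + c • s3 a v w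
  · linear_combination (norm := module) lam • h4 a v w + c • s4 a v w

/-- If `β` is balanced, `A`-invariant of mass `κ ≠ 0` and equivalent of
mass `λ`, then `u ·± v := λ u·v ∓ 2 l(β(u))v` are Novikov products making
`(M, ·±, l, r)` `A`-bimodule Novikov algebras. -/
theorem twisted_products_are_bimoduleNovikov
    {k : Type*} [Field k] [CharZero k]
    {A : Type*} [AddCommGroup A] [Module k A]
    {M : Type*} [AddCommGroup M] [Module k M]
    (mulA : A →ₗ[k] A →ₗ[k] A) (hA : IsNovikov mulA)
    (mulM : M →ₗ[k] M →ₗ[k] M) (l r : A →ₗ[k] Module.End k M)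
    (hM : IsBimoduleNovikovAlgebra mulA mulM l r)
    (lam κ : k) (hκ : κ ≠ 0) (β : M →ₗ[k] A)
    (hbal : IsBalanced l r β)
    (hinv : IsAInvariant mulA l r κ β)
    (heqv : IsEquivalentOfMass mulM l r lam β)
    (mulP mulN : M →ₗ[k] M →ₗ[k] M)
    (hP : ∀ u v : M, mulP u v = lam • mulM u v - (2 : k) • l (β u) v)
    (hN : ∀ u v : M, mulN u v = lam • mulM u v + (2 : k) • l (β u) v) :
    IsNovikov mulP ∧ IsNovikov mulN ∧
    IsBimoduleNovikovAlgebra mulA mulP l r ∧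
    IsBimoduleNovikovAlgebra mulA mulN l r := by
  have hP' := hM.of_twist hκ hbal hinv heqv (-2) (mul := mulP) fun u v => by
    rw [hP, neg_smul, sub_eq_add_neg]
  have hN' := hM.of_twist hκ hbal hinv heqv 2 hN
  exact ⟨hP'.1, hN'.1, hP', hN'⟩
end

section
/- Let (A, ∘) be a Novikov algebra, (M, ·, l, r) an A-bimodule Novikov algebra, λ ∈ k, and α, β : M → A linear maps, where β is balanced, A-invariant of mass κ ≠ 0, and equivalent of mass λ. Define u ·± v := λ u·v ∓ 2 l(β(u))v on M (so (M, ·±, l, r) are A-bimodule Novikov algebras). Then, for either choice of sign, α is an extended O-operator of weight λ with extension β of mass (−1, ±λ) on (A, ∘) associated to (M, ·, l, r) if and only if δ± := α ± β is an O-operator of weight 1 on (A, ∘) associated to (M, ·±, l, r), i.e. δ±(u)∘δ±(v) = δ±(l(δ±(u))v + r(δ±(v))u + u ·± v) for all u, v ∈ M. -/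
open TensorProduct


/-- A nonzero mass can be cancelled from `A`-invariance, leaving a bimodule homomorphism. -/
theorem IsAInvariant.isBimoduleHom {k A M : Type*} [Field k]
    [AddCommGroup A] [Module k A] [AddCommGroup M] [Module k M]
    {mulA : A →ₗ[k] A →ₗ[k] A} {l r : A →ₗ[k] Module.End k M} {κ : k} {β : M →ₗ[k] A}
    (h : IsAInvariant mulA l r κ β) (hκ : κ ≠ 0) : IsBimoduleHom mulA l r β :=
  ⟨fun x u => (smul_right_injective A hκ (h.1 x u)).symm,
    fun x u => (smul_right_injective A hκ (h.2 x u)).symm⟩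

/-- Under the hypotheses on `β`, `α` is an extended O-operator of weight
`λ` with extension `β` of mass `(−1, ±λ)` iff `δ± = α ± β` is an O-operator of weight `1`
associated to `(M, ·±, l, r)` with `u ·± v = λ u·v ∓ 2 l(β(u))v`. -/
theorem extendedOOperator_iff_delta_oOperator
    {k : Type*} [Field k] [CharZero k]
    {A : Type*} [AddCommGroup A] [Module k A]
    {M : Type*} [AddCommGroup M] [Module k M]
    (mulA : A →ₗ[k] A →ₗ[k] A) (hA : IsNovikov mulA)
    (mulM : M →ₗ[k] M →ₗ[k] M) (l r : A →ₗ[k] Module.End k M)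
    (hM : IsBimoduleNovikovAlgebra mulA mulM l r)
    (lam κ : k) (hκ : κ ≠ 0) (α β : M →ₗ[k] A)
    (hbal : IsBalanced l r β)
    (hinv : IsAInvariant mulA l r κ β)
    (heqv : IsEquivalentOfMass mulM l r lam β)
    (ε : k) (hε : ε = 1 ∨ ε = -1)
    (mulE : M →ₗ[k] M →ₗ[k] M)
    (hE : ∀ u v : M, mulE u v = lam • mulM u v - (2 * ε) • l (β u) v) :
    IsExtendedOOperator mulA mulM l r lam (-1) (ε * lam) α β ↔
      IsOOperator mulA mulE l r 1 (α + ε • β) := by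
  have hhom := hinv.isBimoduleHom hκ
  have hεε : ε * ε = 1 := by rcases hε with rfl | rfl <;> norm_num
  have hsum (u v : M) : l ((α + ε • β) u) v + r ((α + ε • β) v) u + (1 : k) • mulE u v
      = l (α u) v + r (α v) u + lam • mulM u v := by
    simp only [hE, LinearMap.add_apply, LinearMap.smul_apply, map_add, map_smul, ← hbal u v]
    module
  have hdefect (u v : M) : mulA ((α + ε • β) u) ((α + ε • β) v)
        - (α + ε • β) (l (α u) v + r (α v) u + lam • mulM u v)
      = (mulA (α u) (α v) - α (l (α u) v + r (α v) u + lam • mulM u v))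
        - ((-1 : k) • mulA (β u) (β v) + (ε * lam) • β (mulM u v)) := by
    have hββ : ε • ε • mulA (β u) (β v) = mulA (β u) (β v) := by
      rw [smul_smul, hεε, one_smul]
    simp only [LinearMap.add_apply, LinearMap.smul_apply, map_add, map_smul, smul_add,
      hhom.1, hhom.2, hββ]
    module
  constructor
  · rintro ⟨-, -, -, h⟩ u v
    rw [hsum, ← sub_eq_zero, hdefect, h, sub_self]
  · refine fun h => ⟨hbal, ⟨fun x u => by rw [hhom.1], fun x u => by rw [hhom.2]⟩,
      ⟨fun u v w => ?_, fun u v w => ?_⟩, fun u v => ?_⟩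
    · rw [mul_smul, heqv.1, mul_smul]
    · rw [mul_smul, heqv.2, mul_smul]
    · rw [← sub_eq_zero, ← hdefect, h, hsum, sub_self]
end

section
/- Let (A, ∘) be a Novikov algebra, T : A → A a linear map, λ ∈ k, and set κ̂ := −1 ± λ (for a fixed choice of sign). Then T satisfies T(x)∘T(y) − T(T(x)∘y + x∘T(y) + λ x∘y) = κ̂ x∘y for all x, y ∈ A if and only if T ± id is a Rota-Baxter operator of weight λ ∓ 2 on (A, ∘). In particular (the case λ = 0, κ̂ = −1): T satisfies T(x)∘T(y) − T(T(x)∘y + x∘T(y)) = −x∘y for all x, y ∈ A if and only if T ± id is a Rota-Baxter operator of weight ∓2. -/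
open TensorProduct


/-- The defect of the weight `lam - 2 * ε` Rota-Baxter identity for `T + ε • id`, with `ε ^ 2 = 1`,
in terms of the defect of the weight `lam` identity for `T`. -/
theorem shifted_rotaBaxter_defect
    {k : Type*} [Field k] {A : Type*} [AddCommGroup A] [Module k A]
    (mulA : A →ₗ[k] A →ₗ[k] A) (T : A →ₗ[k] A) {ε : k} (hε : ε * ε = 1) (lam : k) (x y : A) :
    mulA ((T + ε • LinearMap.id : A →ₗ[k] A) x) ((T + ε • LinearMap.id : A →ₗ[k] A) y)
        - (T + ε • LinearMap.id : A →ₗ[k] A) (mulA ((T + ε • LinearMap.id : A →ₗ[k] A) x) y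
            + mulA x ((T + ε • LinearMap.id : A →ₗ[k] A) y) + (lam - 2 * ε) • mulA x y)
      = mulA (T x) (T y) - T (mulA (T x) y + mulA x (T y) + lam • mulA x y)
        - (-1 + ε * lam) • mulA x y := by
  simp only [LinearMap.add_apply, LinearMap.smul_apply, LinearMap.id_apply, map_add, map_smul]
  linear_combination (norm := module) hε • mulA x y

/-- With `κ̂ = −1 ± λ`, `T` satisfies
`T(x)∘T(y) − T(T(x)∘y + x∘T(y) + λx∘y) = κ̂ x∘y` iff `T ± id` is a Rota-Baxter operator of
weight `λ ∓ 2`; in particular (`λ = 0`), `T` is a Baxter operator iff `T ± id` is a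
Rota-Baxter operator of weight `∓2`. -/
theorem shifted_rotaBaxter_characterization
    {k : Type*} [Field k] [CharZero k]
    {A : Type*} [AddCommGroup A] [Module k A]
    (mulA : A →ₗ[k] A →ₗ[k] A) (hA : IsNovikov mulA)
    (T : A →ₗ[k] A) (ε : k) (hε : ε = 1 ∨ ε = -1) :
    (∀ lam : k,
      (∀ x y : A,
          mulA (T x) (T y) - T (mulA (T x) y + mulA x (T y) + lam • mulA x y)
            = (-1 + ε * lam) • mulA x y) ↔
        IsRotaBaxter mulA (lam - 2 * ε) (T + ε • LinearMap.id)) ∧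
    ((∀ x y : A,
        mulA (T x) (T y) - T (mulA (T x) y + mulA x (T y)) = - mulA x y) ↔
      IsRotaBaxter mulA (-(2 * ε)) (T + ε • LinearMap.id)) := by
  have hε2 : ε * ε = 1 := by rcases hε with rfl | rfl <;> ring
  have key : ∀ lam : k,
      (∀ x y : A,
          mulA (T x) (T y) - T (mulA (T x) y + mulA x (T y) + lam • mulA x y)
            = (-1 + ε * lam) • mulA x y) ↔
        IsRotaBaxter mulA (lam - 2 * ε) (T + ε • LinearMap.id) := by
    intro lam
    refine forall₂_congr fun x y => ?_
    rw [← sub_eq_zero, ← shifted_rotaBaxter_defect mulA T hε2 lam x y, sub_eq_zero]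
  exact ⟨key, by simpa using key 0⟩
end

section
/- Let (A, ∘) be a finite-dimensional Novikov algebra and s ∈ A⊗A symmetric (τ(s) = s), with associated linear map ŝ : A* → A, ⟨ŝ(a*), b*⟩ = ⟨a*⊗b*, s⟩. Then the following are equivalent: (i) s is invariant, i.e. (L_A(x)⊗id + id⊗L_{A,⋆}(x))s = 0 for all x ∈ A; (ii) ŝ is balanced with respect to the bimodule (A*, L_{A,⋆}*, −R_A*), i.e. L_{A,⋆}*(ŝ(a*))b* = −R_A*(ŝ(b*))a* for all a*, b* ∈ A*; (iii) ŝ is an A-bimodule homomorphism from (A*, L_{A,⋆}*, −R_A*) to (A, L_A, R_A), i.e. ŝ(L_{A,⋆}*(x)a*) = x∘ŝ(a*) and ŝ(−R_A*(x)a*) = ŝ(a*)∘x for all x ∈ A, a* ∈ A*. -/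
open TensorProduct


section DualDefs
variable {k : Type*} [Field k] [CharZero k]
variable {A : Type*} [AddCommGroup A] [Module k A]
variable {M : Type*} [AddCommGroup M] [Module k M]

/-- The dual representation `φ*` of `φ : A → End M`, with `⟨φ*(a) f, v⟩ = −⟨f, φ(a) v⟩`. -/
noncomputable def dualRep (φ : A →ₗ[k] Module.End k M) :
    A →ₗ[k] Module.End k (Module.Dual k M) :=
  (Module.Dual.transpose (R := k)) ∘ₗ (-φ)


/-- The negative `−φ*` of the dual representation, i.e. `a ↦ (f ↦ f ∘ φ(a))`;
for `φ = R` this is the action `−R*`. -/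
noncomputable def negDualRep (φ : A →ₗ[k] Module.End k M) :
    A →ₗ[k] Module.End k (Module.Dual k M) :=
  (Module.Dual.transpose (R := k)) ∘ₗ φ

/-- The linear map `A ⊗ A → Hom(A*, A)`, `x ⊗ y ↦ (f ↦ f(x) • y)`, sending `r` to `r̂`. -/
noncomputable def hatMap : A ⊗[k] A →ₗ[k] (Module.Dual k A →ₗ[k] A) :=
  TensorProduct.lift
    (LinearMap.mk₂ k (fun x y => LinearMap.smulRight (Module.Dual.eval k A x) y)
      (fun x x' y => by
        ext f
        simp only [LinearMap.smulRight_apply, Module.Dual.eval_apply, LinearMap.add_apply,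
          map_add, add_smul])
      (fun c x y => by
        ext f
        simp only [LinearMap.smulRight_apply, Module.Dual.eval_apply, LinearMap.smul_apply,
          map_smul, smul_assoc])
      (fun x y y' => by
        ext f
        simp only [LinearMap.smulRight_apply, Module.Dual.eval_apply, LinearMap.add_apply,
          smul_add])
      (fun c x y => by
        ext f
        exact smul_comm _ _ _))

/-- `s ∈ A ⊗ A` is invariant: `(L(x) ⊗ id + id ⊗ L⋆(x)) s = 0` for all `x ∈ A`. -/
def IsInvariantTensor (mulA : A →ₗ[k] A →ₗ[k] A) (s : A ⊗[k] A) : Prop :=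
  ∀ x : A, TensorProduct.map (mulA x) LinearMap.id s
      + TensorProduct.map LinearMap.id ((mulA + mulA.flip) x) s = 0

/-- The bilinear operation sending `(r, r')` to `r₁₃ ∘ r'₂₃ = Σ xᵢ ⊗ x'ⱼ ⊗ (yᵢ ∘ y'ⱼ)`. -/
noncomputable def t1323 (m : A →ₗ[k] A →ₗ[k] A) :
    (A ⊗[k] A) ⊗[k] (A ⊗[k] A) →ₗ[k] (A ⊗[k] A) ⊗[k] A :=
  TensorProduct.map LinearMap.id (TensorProduct.lift m) ∘ₗ
    (TensorProduct.tensorTensorTensorComm k A A A A).toLinearMap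

/-- The bilinear operation sending `(r, r')` to `r₁₂ m r'₂₃ = Σ xᵢ ⊗ (yᵢ m x'ⱼ) ⊗ y'ⱼ`. -/
noncomputable def t1223 (m : A →ₗ[k] A →ₗ[k] A) :
    (A ⊗[k] A) ⊗[k] (A ⊗[k] A) →ₗ[k] (A ⊗[k] A) ⊗[k] A :=
  (TensorProduct.assoc k A A A).symm.toLinearMap ∘ₗ
  TensorProduct.map LinearMap.id
    (TensorProduct.map (TensorProduct.lift m) LinearMap.id ∘ₗ
      (TensorProduct.assoc k A A A).symm.toLinearMap) ∘ₗ
  (TensorProduct.assoc k A A (A ⊗[k] A)).toLinearMap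

/-- The bilinear operation sending `(r, r')` to `r₁₃ ∘ r'₁₂ = Σ (xᵢ ∘ x'ⱼ) ⊗ y'ⱼ ⊗ yᵢ`. -/
noncomputable def t1312 (m : A →ₗ[k] A →ₗ[k] A) :
    (A ⊗[k] A) ⊗[k] (A ⊗[k] A) →ₗ[k] (A ⊗[k] A) ⊗[k] A :=
  (TensorProduct.assoc k A A A).symm.toLinearMap ∘ₗ
  TensorProduct.map (TensorProduct.lift m) (TensorProduct.comm k A A).toLinearMap ∘ₗ
  (TensorProduct.tensorTensorTensorComm k A A A A).toLinearMap

/-- `r₁₃∘r₂₃ + r₁₂⋆r₂₃ + r₁₃∘r₁₂` as an element of `A ⊗ A ⊗ A` (grouping `(A ⊗ A) ⊗ A`). -/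
noncomputable def nybeLHS (mulA : A →ₗ[k] A →ₗ[k] A) (r : A ⊗[k] A) : (A ⊗[k] A) ⊗[k] A :=
  t1323 mulA (r ⊗ₜ[k] r) + t1223 (mulA + mulA.flip) (r ⊗ₜ[k] r) + t1312 mulA (r ⊗ₜ[k] r)

/-- `r` is a solution of the Novikov Yang–Baxter equation in `A`. -/
def IsNYBESolution (mulA : A →ₗ[k] A →ₗ[k] A) (r : A ⊗[k] A) : Prop :=
  nybeLHS mulA r = 0

/-- `r` is a solution of the extended Novikov Yang–Baxter equation of mass `ε` in `A`. -/
def IsENYBESolution (mulA : A →ₗ[k] A →ₗ[k] A) (ε : k) (r : A ⊗[k] A) : Prop :=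
  nybeLHS mulA r
    = ε • t1323 mulA ((r + TensorProduct.comm k A A r) ⊗ₜ[k] (r + TensorProduct.comm k A A r))

end DualDefs

section HatMap

variable {k : Type*} [Field k]
variable {A : Type*} [AddCommGroup A] [Module k A]

theorem hatMap_tmul (x y : A) (f : Module.Dual k A) : hatMap (x ⊗ₜ[k] y) f = f x • y := rfl

/-- A tensor is determined by its associated linear map. -/
theorem hatMap_injective : Function.Injective (hatMap (k := k) (A := A)) := by
  intro t t' h
  let b := Module.Free.chooseBasis k A
  have coord_eq (t : A ⊗[k] A) (i j) :
      (b.tensorProduct b).repr t (i, j) = b.coord j (hatMap t (b.coord i)) := by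
    induction t with
    | zero => simp
    | tmul x y => simp [hatMap_tmul, mul_comm]
    | add x y hx hy => simp only [map_add, Finsupp.add_apply, LinearMap.add_apply, hx, hy]
  refine (b.tensorProduct b).ext_elem fun ⟨i, j⟩ => ?_
  rw [coord_eq, coord_eq, h]

theorem hatMap_map (φ ψ : Module.End k A) (t : A ⊗[k] A) (f : Module.Dual k A) :
    hatMap (TensorProduct.map φ ψ t) f = ψ (hatMap t (f ∘ₗ φ)) := by
  induction t with
  | zero => simp
  | tmul x y => simp [hatMap_tmul]
  | add x y hx hy => simp only [map_add, LinearMap.add_apply, hx, hy]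

theorem dual_hatMap_comm (t : A ⊗[k] A) (f g : Module.Dual k A) :
    g (hatMap (TensorProduct.comm k A A t) f) = f (hatMap t g) := by
  induction t with
  | zero => simp
  | tmul x y => simp [hatMap_tmul, mul_comm]
  | add x y hx hy => simp only [map_add, LinearMap.add_apply, hx, hy]

theorem dual_hatMap_swap {s : A ⊗[k] A} (hs : TensorProduct.comm k A A s = s)
    (f g : Module.Dual k A) : g (hatMap s f) = f (hatMap s g) := by
  conv_lhs => rw [← hs]
  exact dual_hatMap_comm s f g

theorem dualRep_apply (φ : A →ₗ[k] Module.End k A) (x y : A) (f : Module.Dual k A) :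
    dualRep φ x f y = -f (φ x y) := by
  change f (-(φ x y)) = _
  exact map_neg f _

theorem negDualRep_apply (φ : A →ₗ[k] Module.End k A) (x y : A) (f : Module.Dual k A) :
    negDualRep φ x f y = f (φ x y) := rfl

/-- Invariance of a symmetric tensor, paired with two linear forms. -/
theorem isInvariantTensor_iff_forall_dual (mulA : A →ₗ[k] A →ₗ[k] A) {s : A ⊗[k] A}
    (hs : TensorProduct.comm k A A s = s) :
    IsInvariantTensor mulA s ↔ ∀ (x : A) (f g : Module.Dual k A),
      f (mulA x (hatMap s g)) + g (mulA x (hatMap s f) + mulA (hatMap s f) x) = 0 := by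
  refine forall_congr' fun x => ?_
  rw [← hatMap_injective.eq_iff, map_zero, LinearMap.ext_iff]
  refine forall_congr' fun f => ?_
  rw [LinearMap.zero_apply, ← Module.forall_dual_apply_eq_zero_iff k]
  refine forall_congr' fun g => ?_
  simp only [map_add, LinearMap.add_apply, hatMap_map, LinearMap.id_apply, LinearMap.flip_apply,
    LinearMap.comp_id, dual_hatMap_swap hs (f ∘ₗ mulA x) g, LinearMap.comp_apply]

end HatMap

/-- For a symmetric `s ∈ A ⊗ A` the following are equivalent:
invariance of `s`; `ŝ` balanced w.r.t. `(A*, L⋆*, −R*)`; `ŝ` an `A`-bimodule homomorphism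
from `(A*, L⋆*, −R*)` to `(A, L, R)`. -/
theorem symmetric_invariant_iff_balanced_iff_bimoduleHom
    {k : Type*} [Field k] [CharZero k]
    {A : Type*} [AddCommGroup A] [Module k A] [FiniteDimensional k A]
    (mulA : A →ₗ[k] A →ₗ[k] A) (hA : IsNovikov mulA)
    (s : A ⊗[k] A) (hs : TensorProduct.comm k A A s = s) :
    (IsInvariantTensor mulA s ↔
      IsBalanced (dualRep (mulA + mulA.flip)) (negDualRep mulA.flip) (hatMap s)) ∧
    (IsInvariantTensor mulA s ↔
      IsBimoduleHom mulA (dualRep (mulA + mulA.flip)) (negDualRep mulA.flip) (hatMap s)) := by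
  rw [isInvariantTensor_iff_forall_dual mulA hs]
  refine ⟨⟨fun h u v => ?_, fun h x f g => ?_⟩, fun h => ⟨fun x u => ?_, fun x u => ?_⟩,
    fun h x f g => ?_⟩
  · ext x
    have := h x u v
    simp only [dualRep_apply, negDualRep_apply, LinearMap.add_apply, LinearMap.flip_apply,
      map_add] at this ⊢
    linear_combination -this
  · have := LinearMap.congr_fun (h f g) x
    simp only [dualRep_apply, negDualRep_apply, LinearMap.add_apply, LinearMap.flip_apply,
      map_add] at this ⊢
    linear_combination -this
  · refine Module.eval_apply_injective k (LinearMap.ext fun g => ?_)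
    rw [Module.Dual.eval_apply, Module.Dual.eval_apply]
    have := h x g u
    rw [dual_hatMap_swap hs]
    simp only [dualRep_apply, LinearMap.add_apply, LinearMap.flip_apply, map_add] at this ⊢
    linear_combination -this
  · refine Module.eval_apply_injective k (LinearMap.ext fun g => ?_)
    rw [Module.Dual.eval_apply, Module.Dual.eval_apply]
    have h₁ := h x g u
    have h₂ := h x u g
    rw [dual_hatMap_swap hs]
    simp only [negDualRep_apply, LinearMap.flip_apply, map_add] at h₁ h₂ ⊢
    linear_combination h₁ - h₂
  · have := congrArg f (h.1 x g)
    rw [dual_hatMap_swap hs] at this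
    simp only [dualRep_apply, LinearMap.add_apply, LinearMap.flip_apply, map_add] at this ⊢
    linear_combination -this
end

section
/- Let (A, ∘) be a finite-dimensional Novikov algebra, r ∈ A⊗A, and write r̂ = α + β where α := (r̂ − r̂ᵗ)/2 and β := (r̂ + r̂ᵗ)/2. Assume the symmetric part (r + τr)/2 of r is invariant, i.e. (L_A(x)⊗id + id⊗L_{A,⋆}(x))(r + τr) = 0 for all x ∈ A. Then, for κ ∈ k, r satisfies r₁₃∘r₂₃ + r₁₂⋆r₂₃ + r₁₃∘r₁₂ = ((κ+1)/4) (r+τr)₁₃∘(r+τr)₂₃ if and only if α(a*)∘α(b*) − α(L_{A,⋆}*(α(a*))b* − R_A*(α(b*))a*) = κ β(a*)∘β(b*) for all a*, b* ∈ A* (i.e. α is an extended O-operator of weight 0 with extension β of mass (κ, 0) on (A, ∘) associated to (A*, L_{A,⋆}*, −R_A*)). -/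
open TensorProduct


section PairingLemmas

variable {k : Type*} [Field k]
variable {A : Type*} [AddCommGroup A] [Module k A]

/-- Evaluation of `a ⊗ b ⊗ c` on `A ⊗ A ⊗ A`. -/
noncomputable def tripleEval (a b c : Module.Dual k A) : (A ⊗[k] A) ⊗[k] A →ₗ[k] k :=
  (TensorProduct.lid k k).toLinearMap ∘ₗ
    TensorProduct.map ((TensorProduct.lid k k).toLinearMap ∘ₗ TensorProduct.map a b) c

theorem tripleEval_tmul (a b c : Module.Dual k A) (x y z : A) :
    tripleEval a b c ((x ⊗ₜ[k] y) ⊗ₜ[k] z) = a x * b y * c z := by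
  simp [tripleEval]

theorem eq_of_tripleEval_eq [FiniteDimensional k A] {s t : (A ⊗[k] A) ⊗[k] A}
    (h : ∀ a b c : Module.Dual k A, tripleEval a b c s = tripleEval a b c t) : s = t := by
  let B := Module.finBasis k A
  refine ((B.tensorProduct B).tensorProduct B).ext_elem fun ⟨⟨i, j⟩, l⟩ => ?_
  have key : ∀ u : (A ⊗[k] A) ⊗[k] A, ((B.tensorProduct B).tensorProduct B).repr u ((i, j), l)
      = tripleEval (B.coord i) (B.coord j) (B.coord l) u := by
    intro u
    have : ((B.tensorProduct B).tensorProduct B).coord ((i, j), l)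
        = tripleEval (B.coord i) (B.coord j) (B.coord l) := by
      ext x y z
      simp [tripleEval_tmul, mul_comm]
    exact LinearMap.congr_fun this u
  rw [key, key, h]

theorem apply_hatMap_comm (r : A ⊗[k] A) (f g : Module.Dual k A) :
    g (hatMap (TensorProduct.comm k A A r) f) = f (hatMap r g) := by
  induction r with
  | zero => simp
  | tmul x y => simp [hatMap_tmul, mul_comm]
  | add r s hr hs => simp only [map_add, LinearMap.add_apply, hr, hs]

theorem tripleEval_t1323 (m : A →ₗ[k] A →ₗ[k] A) (r s : A ⊗[k] A) (a b c : Module.Dual k A) :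
    tripleEval a b c (t1323 m (r ⊗ₜ[k] s)) = c (m (hatMap r a) (hatMap s b)) := by
  induction r with
  | zero => simp
  | add r r' hr hr' => simp only [add_tmul, map_add, LinearMap.add_apply, hr, hr']
  | tmul x y =>
    induction s with
    | zero => simp
    | add s s' hs hs' => simp only [tmul_add, map_add, LinearMap.add_apply, hs, hs']
    | tmul x' y' => simp [t1323, hatMap_tmul, tripleEval_tmul]; ring

theorem tripleEval_t1223 (m : A →ₗ[k] A →ₗ[k] A) (r s : A ⊗[k] A) (a b c : Module.Dual k A) :
    tripleEval a b c (t1223 m (r ⊗ₜ[k] s))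
      = b (m (hatMap r a) (hatMap (TensorProduct.comm k A A s) c)) := by
  induction r with
  | zero => simp
  | add r r' hr hr' => simp only [add_tmul, map_add, LinearMap.add_apply, hr, hr']
  | tmul x y =>
    induction s with
    | zero => simp
    | add s s' hs hs' => simp only [tmul_add, map_add, LinearMap.add_apply, hs, hs']
    | tmul x' y' => simp [t1223, hatMap_tmul, tripleEval_tmul]; ring

theorem tripleEval_t1312 (m : A →ₗ[k] A →ₗ[k] A) (r s : A ⊗[k] A) (a b c : Module.Dual k A) :
    tripleEval a b c (t1312 m (r ⊗ₜ[k] s))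
      = a (m (hatMap (TensorProduct.comm k A A r) c) (hatMap (TensorProduct.comm k A A s) b)) := by
  induction r with
  | zero => simp
  | add r r' hr hr' => simp only [add_tmul, map_add, LinearMap.add_apply, hr, hr']
  | tmul x y =>
    induction s with
    | zero => simp
    | add s s' hs hs' => simp only [tmul_add, map_add, LinearMap.add_apply, hs, hs']
    | tmul x' y' => simp [t1312, hatMap_tmul, tripleEval_tmul]; ring

theorem apply_hatMap_map (φ ψ : A →ₗ[k] A) (s : A ⊗[k] A) (f g : Module.Dual k A) :
    g (hatMap (TensorProduct.map φ ψ s) f) = g (ψ (hatMap s (f ∘ₗ φ))) := by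
  induction s with
  | zero => simp
  | tmul x y => simp [hatMap_tmul]
  | add r s hr hs => simp only [map_add, LinearMap.add_apply, hr, hs]

/-- Invariance of a symmetric tensor, expressed through the associated map `β = ŝ`. -/
theorem IsInvariantTensor.apply_add_apply_eq_zero {mul : A →ₗ[k] A →ₗ[k] A} {s : A ⊗[k] A}
    (hs : IsInvariantTensor mul s)
    (hsymm : ∀ f g : Module.Dual k A, g (hatMap s f) = f (hatMap s g))
    (x : A) (f g : Module.Dual k A) :
    f (mul x (hatMap s g)) + g (mul x (hatMap s f) + mul (hatMap s f) x) = 0 := by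
  have h := congrArg (fun t => g (hatMap t f)) (hs x)
  simp only [map_add, LinearMap.add_apply, apply_hatMap_map, map_zero, LinearMap.zero_apply,
    LinearMap.flip_apply, LinearMap.id_apply, LinearMap.comp_id] at h
  rw [hsymm] at h
  simpa using h

end PairingLemmas

/-- If the symmetric part of `r` is invariant, then `r` satisfies the
ENYBE of mass `(κ+1)/4` iff the skew-symmetric part `α` of `r̂` is an extended O-operator
of weight `0` with extension the symmetric part `β` of `r̂`, of mass `(κ, 0)`. -/
theorem enybe_iff_extendedOOperator
    {k : Type*} [Field k] [CharZero k]
    {A : Type*} [AddCommGroup A] [Module k A] [FiniteDimensional k A]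
    (mulA : A →ₗ[k] A →ₗ[k] A) (hA : IsNovikov mulA) (r : A ⊗[k] A) (κ : k)
    (hinv : IsInvariantTensor mulA ((2 : k)⁻¹ • (r + TensorProduct.comm k A A r)))
    (α β : Module.Dual k A →ₗ[k] A)
    (hα : α = (2 : k)⁻¹ • (hatMap r - hatMap (TensorProduct.comm k A A r)))
    (hβ : β = (2 : k)⁻¹ • (hatMap r + hatMap (TensorProduct.comm k A A r))) :
    IsENYBESolution mulA ((κ + 1) / 4) r ↔
      ∀ a b : Module.Dual k A,
        mulA (α a) (α b)
            - α (dualRep (mulA + mulA.flip) (α a) b - dualRep mulA.flip (α b) a)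
          = κ • mulA (β a) (β b) := by
  have hβs : β = hatMap ((2 : k)⁻¹ • (r + TensorProduct.comm k A A r)) := by
    rw [hβ, map_smul, map_add]
  have hP : hatMap r = α + β := by
    rw [hα, hβ, ← smul_add, sub_add_add_cancel, ← two_smul k, smul_smul,
      inv_mul_cancel₀ two_ne_zero, one_smul]
  have hQ : hatMap (TensorProduct.comm k A A r) = β - α := by
    rw [hα, hβ, ← smul_sub, add_sub_sub_cancel, ← two_smul k, smul_smul,
      inv_mul_cancel₀ two_ne_zero, one_smul]
  have hS : hatMap (r + TensorProduct.comm k A A r) = (2 : k) • β := by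
    rw [map_add, hP, hQ, two_smul]; abel
  have hadj : ∀ f g : Module.Dual k A, g (hatMap (TensorProduct.comm k A A r) f)
      = f (hatMap r g) := apply_hatMap_comm r
  have hαskew : ∀ f g : Module.Dual k A, g (α f) = -f (α g) := by
    intro f g
    simp only [hα, LinearMap.smul_apply, LinearMap.sub_apply, map_smul, map_sub, hadj, smul_eq_mul]
    ring
  have hβsymm : ∀ f g : Module.Dual k A, g (β f) = f (β g) := by
    intro f g
    simp only [hβ, LinearMap.smul_apply, LinearMap.add_apply, map_smul, map_add, hadj, smul_eq_mul]
    ring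
  have inv : ∀ (x : A) (f g : Module.Dual k A),
      f (mulA x (β g)) + g (mulA x (β f)) + g (mulA (β f) x) = 0 := by
    intro x f g
    have h := hinv.apply_add_apply_eq_zero (hβs ▸ hβsymm) x f g
    rwa [← hβs, map_add, ← add_assoc] at h
  have hLHS : ∀ a b c : Module.Dual k A, tripleEval a b c (nybeLHS mulA r)
      = c (mulA (α a) (α b)) - b (mulA (α a) (α c) + mulA (α c) (α a)) + a (mulA (α c) (α b))
        + c (mulA (β a) (β b)) := by
    intro a b c
    simp only [nybeLHS, map_add, tripleEval_t1323, tripleEval_t1223, tripleEval_t1312, hP, hQ,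
      LinearMap.add_apply, LinearMap.sub_apply, LinearMap.flip_apply, map_sub]
    linear_combination inv (β c) a b + inv (α a) c b - inv (α c) a b + inv (α b) a c
      - inv (α b) c a
  have hRHS : ∀ a b c : Module.Dual k A, tripleEval a b c (((κ + 1) / 4) •
        t1323 mulA ((r + TensorProduct.comm k A A r) ⊗ₜ[k] (r + TensorProduct.comm k A A r)))
      = (κ + 1) * c (mulA (β a) (β b)) := by
    intro a b c
    simp only [map_smul, tripleEval_t1323, hS, LinearMap.smul_apply, smul_eq_mul]
    ring
  have hO : ∀ a b c : Module.Dual k A, c (mulA (α a) (α b)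
        - α (dualRep (mulA + mulA.flip) (α a) b - dualRep mulA.flip (α b) a))
      = c (mulA (α a) (α b)) - b (mulA (α a) (α c) + mulA (α c) (α a))
        + a (mulA (α c) (α b)) := by
    intro a b c
    rw [map_sub, hαskew]
    simp [dualRep, Module.Dual.transpose_apply]
    ring
  constructor
  · intro h a b
    refine Module.forall_dual_apply_eq_zero_iff k _ |>.1 (fun c => ?_) |> sub_eq_zero.1
    have h' := congrArg (tripleEval a b c) h
    rw [hLHS, hRHS] at h'
    rw [map_sub, hO, map_smul, smul_eq_mul]
    linear_combination h'
  · intro h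
    refine eq_of_tripleEval_eq fun a b c => ?_
    have h' := congrArg c (h a b)
    rw [hO, map_smul, smul_eq_mul] at h'
    rw [hLHS, hRHS]
    linear_combination h'
end
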